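/- Let M be a smooth hypersurface of R^{n+1} with n ≥ 3, a Hardy inequality of Carron type with an improved term holds: for every φ ∈ C^1_c(M), ((n−2)²/4)∫_M φ²/|x|² dV + ((n²−4)/4)∫_M ((x/|x|)·ν_M)² φ²/|x|² dV ≤ ∫_M (|∇_T φ|² + ((n−2)/2)|H|φ²/|x|) dV. -/

import Mathlib

open MeasureTheory
open scoped RealInnerProductSpace

noncomputable section

/-- Ambient Euclidean space `ℝ^{n+1}`. -/
abbrev Eu (n : ℕ) := EuclideanSpace ℝ (Fin (n + 1))

/-- A smooth `n`-dimensional hypersurface of `ℝ^{n+1}`, described by its carrier set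
together with a smooth unit normal field; locally it is a regular level set of a
smooth function. -/
structure Hypersurface (n : ℕ) where
  carrier : Set (Eu n)
  nu : Eu n → Eu n
  smooth_nu : ContDiff ℝ (⊤ : ℕ∞) nu
  unit_nu : ∀ x ∈ carrier, ‖nu x‖ = 1
  locally_level_set : ∀ x ∈ carrier, ∃ U : Set (Eu n), IsOpen U ∧ x ∈ U ∧
    ∃ f : Eu n → ℝ, ContDiff ℝ (⊤ : ℕ∞) f ∧
      carrier ∩ U = {y ∈ U | f y = 0} ∧
      (∀ y ∈ U, gradient f y ≠ 0) ∧
      (∀ y ∈ carrier ∩ U, nu y = ‖gradient f y‖⁻¹ • gradient f y)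

variable {n : ℕ}

/-- The `i`-th tangential derivative `δ_i φ = ∂_i φ − ν^i ∑_j (∂_j φ) ν^j`. -/
def tderiv (ν : Eu n → Eu n) (i : Fin (n + 1)) (φ : Eu n → ℝ) (x : Eu n) : ℝ :=
  fderiv ℝ φ x (EuclideanSpace.single i 1)
    - ν x i * ∑ j, fderiv ℝ φ x (EuclideanSpace.single j 1) * ν x j

/-- The tangential gradient `∇_T φ = ∇φ − (∇φ·ν)ν`. -/
def tgrad (ν : Eu n → Eu n) (φ : Eu n → ℝ) (x : Eu n) : Eu n :=
  gradient φ x - ⟪gradient φ x, ν x⟫ • ν x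

/-- The tangential divergence `div_T Z = ∑ i δ_i Z^i`. -/
def tdiv (ν : Eu n → Eu n) (Z : Eu n → Eu n) (x : Eu n) : ℝ :=
  ∑ i, tderiv ν i (fun y => Z y i) x

/-- The mean curvature `H = div_T ν` (sum of the principal curvatures). -/
def meanCurv (M : Hypersurface n) (x : Eu n) : ℝ := tdiv M.nu M.nu x

/-- The Laplace–Beltrami operator `Δφ = div_T (∇_T φ)`. -/
def lapBel (ν : Eu n → Eu n) (φ : Eu n → ℝ) (x : Eu n) : ℝ := tdiv ν (tgrad ν φ) x

/-- The surface measure on `M`: the `n`-dimensional Hausdorff measure restricted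
to the carrier of `M`. -/
def surfMeasure (M : Hypersurface n) : Measure (Eu n) :=
  (μH[(n : ℝ)]).restrict M.carrier

/-- `C^1` functions with compact support in a set `S`: ambient `C^1` functions
vanishing on `S` outside a compact subset `K ⊆ S`. -/
def C1cOn (S : Set (Eu n)) (φ : Eu n → ℝ) : Prop :=
  ContDiff ℝ 1 φ ∧ ∃ K : Set (Eu n), IsCompact K ∧ K ⊆ S ∧ ∀ x ∈ S, x ∉ K → φ x = 0

section Helpers

open Filter Topology Set

/-- Parameter space. -/
abbrev Tn (n : ℕ) := EuclideanSpace ℝ (Fin n)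

lemma area_bounds (g : Tn n → Eu n) (p : Eu n → Tn n) (B : Tn n ≃L[ℝ] Tn n) (s : Set (Tn n))
    (hp : ∀ y ∈ s, p (g y) = y) (δ : ℝ) (hδ0 : 0 < δ) (hδ1 : δ < 1)
    (h : ∀ a ∈ s, ∀ b ∈ s, (1 - δ) * ‖B (a - b)‖ ≤ ‖g a - g b‖ ∧
      ‖g a - g b‖ ≤ (1 + δ) * ‖B (a - b)‖) :
    μH[(n : ℝ)] (g '' s) ≤ ENNReal.ofReal ((1 + δ) ^ n * |LinearMap.det (B : Tn n →ₗ[ℝ] Tn n)|)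
        * μH[(n : ℝ)] s ∧
    ENNReal.ofReal ((1 - δ) ^ n * |LinearMap.det (B : Tn n →ₗ[ℝ] Tn n)|) * μH[(n : ℝ)] s
      ≤ μH[(n : ℝ)] (g '' s) := by
  have hBs : μH[(n : ℝ)] (B '' s) =
      ENNReal.ofReal |LinearMap.det (B : Tn n →ₗ[ℝ] Tn n)| * μH[(n : ℝ)] s :=
    Measure.addHaar_image_linearMap _ (B : Tn n →ₗ[ℝ] Tn n) s
  constructor
  · have hl : LipschitzOnWith (Real.toNNReal (1 + δ)) (g ∘ B.symm) (B '' s) := by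
      apply LipschitzOnWith.of_dist_le_mul
      rintro _ ⟨a, ha, rfl⟩ _ ⟨b, hb, rfl⟩
      have := (h a ha b hb).2
      rw [Real.coe_toNNReal _ (by linarith)]
      simpa [dist_eq_norm] using this
    have h1 := hl.hausdorffMeasure_image_le (d := n) (by positivity)
    rw [hBs] at h1
    have h2 : (g ∘ B.symm) '' (B '' s) = g '' s := by
      rw [image_image]; simp
    rw [h2] at h1
    refine h1.trans (le_of_eq ?_)
    rw [ENNReal.ofReal_mul (by positivity), ENNReal.ofReal_pow (by positivity), mul_assoc]
    simp [ENNReal.ofReal]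
  · have hl : LipschitzOnWith (Real.toNNReal (1 - δ)⁻¹) (B ∘ p) (g '' s) := by
      apply LipschitzOnWith.of_dist_le_mul
      rintro _ ⟨a, ha, rfl⟩ _ ⟨b, hb, rfl⟩
      have := (h a ha b hb).1
      rw [Real.coe_toNNReal _ (inv_nonneg.2 (by linarith))]
      simp only [Function.comp, hp a ha, hp b hb, dist_eq_norm]
      rw [← map_sub, inv_mul_eq_div, le_div_iff₀ (by linarith)]
      linarith
    have h1 := hl.hausdorffMeasure_image_le (d := n) (by positivity)
    have h2 : (B ∘ p) '' (g '' s) = B '' s := by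
      rw [image_image]
      exact image_congr fun y hy => by simp [hp y hy]
    rw [h2, hBs] at h1
    have h3 : ((Real.toNNReal (1 - δ)⁻¹ : NNReal) : ENNReal) ^ (n : ℝ)
        = (ENNReal.ofReal ((1 - δ) ^ n))⁻¹ := by
      rw [← ENNReal.ofReal_inv_of_pos (pow_pos (by linarith) _), ← inv_pow,
        ENNReal.ofReal_pow (inv_nonneg.2 (by linarith))]
      simp [ENNReal.ofReal]
    rw [h3] at h1
    rw [ENNReal.ofReal_mul (pow_nonneg (by linarith) _), mul_assoc]
    have h0 : ENNReal.ofReal ((1 - δ) ^ n) ≠ 0 := by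
      simpa using pow_pos (by linarith : 0 < 1 - δ) n
    calc _ ≤ ENNReal.ofReal ((1 - δ) ^ n) * ((ENNReal.ofReal ((1 - δ) ^ n))⁻¹ * μH[(n : ℝ)] (g '' s)) := by
          gcongr
      _ = _ := by
          rw [← mul_assoc, ENNReal.mul_inv_cancel h0 ENNReal.ofReal_ne_top, one_mul]

lemma area_ratio (g : Tn n → Eu n) (p : Eu n → Tn n) (L : Tn n →L[ℝ] Eu n)
    (B : Tn n ≃L[ℝ] Tn n) (y₀ : Tn n)
    (hp : ∀ᶠ y in 𝓝 y₀, p (g y) = y) (hg : HasStrictFDerivAt g L y₀)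
    (hB : ∀ v, ‖L v‖ = ‖B v‖) :
    Tendsto (fun r => μH[(n : ℝ)] (g '' Metric.closedBall y₀ r) /
      μH[(n : ℝ)] (Metric.closedBall y₀ r)) (𝓝[>] 0)
      (𝓝 (ENNReal.ofReal |LinearMap.det (B : Tn n →ₗ[ℝ] Tn n)|)) := by
  set d := |LinearMap.det (B : Tn n →ₗ[ℝ] Tn n)|
  have key : ∀ δ : ℝ, 0 < δ → δ < 1 → ∀ᶠ r in 𝓝[>] (0 : ℝ),
      ENNReal.ofReal ((1 - δ) ^ n * d) ≤ μH[(n : ℝ)] (g '' Metric.closedBall y₀ r) /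
        μH[(n : ℝ)] (Metric.closedBall y₀ r) ∧ μH[(n : ℝ)] (g '' Metric.closedBall y₀ r) /
        μH[(n : ℝ)] (Metric.closedBall y₀ r) ≤ ENNReal.ofReal ((1 + δ) ^ n * d) := by
    intro δ h0 h1
    have hO : (fun q : Tn n × Tn n => q.1 - q.2) =O[𝓝 (y₀, y₀)]
        fun q : Tn n × Tn n => B (q.1 - q.2) := by
      apply Asymptotics.IsBigO.of_bound ‖(B.symm : Tn n →L[ℝ] Tn n)‖
      refine Eventually.of_forall fun q => ?_
      have := (B.symm : Tn n →L[ℝ] Tn n).le_opNorm (B (q.1 - q.2))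
      simpa using this
    have ho := (hg.isLittleO.trans_isBigO hO).bound h0
    rw [nhds_prod_eq] at ho
    obtain ⟨U, hU, hU2⟩ := (eventually_prod_self_iff'.1 ho)
    obtain ⟨r₀, hr₀, hr₀'⟩ := Metric.nhds_basis_closedBall.mem_iff.1 (inter_mem hU hp)
    filter_upwards [Ioc_mem_nhdsGT hr₀] with r hr
    have hsub : Metric.closedBall y₀ r ⊆ Metric.closedBall y₀ r₀ := Metric.closedBall_subset_closedBall hr.2
    have := area_bounds g p B (Metric.closedBall y₀ r) (fun y hy => (hr₀' (hsub hy)).2) δ h0 h1 ?_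
    · have hpos : μH[(n : ℝ)] (Metric.closedBall y₀ r) ≠ 0 :=
        (Metric.measure_closedBall_pos _ _ hr.1).ne'
      have hfin : μH[(n : ℝ)] (Metric.closedBall y₀ r) ≠ ⊤ :=
        measure_closedBall_lt_top.ne
      rw [ENNReal.le_div_iff_mul_le (Or.inl hpos) (Or.inl hfin),
        ENNReal.div_le_iff_le_mul (Or.inl hpos) (Or.inl hfin)]
      exact ⟨this.2, this.1⟩
    · intro a ha b hb
      have h2 := hU2 a (hr₀' (hsub ha)).1 b (hr₀' (hsub hb)).1
      simp only at h2
      have h3 := hB (a - b)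
      have h4 := norm_sub_norm_le (L (a - b)) (g a - g b)
      have h5 := norm_sub_norm_le (g a - g b) (L (a - b))
      rw [norm_sub_rev (L (a-b))] at h4
      constructor <;> linarith
  have hc : ∀ f : ℝ → ℝ, Continuous f → f 0 = d →
      Tendsto (fun δ => ENNReal.ofReal (f δ)) (𝓝[>] 0) (𝓝 (ENNReal.ofReal d)) := by
    intro f hf h0
    have := (ENNReal.continuous_ofReal.comp hf).tendsto 0
    simp only [Function.comp, h0] at this
    exact this.mono_left nhdsWithin_le_nhds
  have hI : ∀ᶠ δ in 𝓝[>] (0 : ℝ), 0 < δ ∧ δ < 1 := by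
    filter_upwards [Ioo_mem_nhdsGT (zero_lt_one)] with δ hδ using hδ
  refine tendsto_order.2 ⟨fun a ha => ?_, fun a ha => ?_⟩
  · obtain ⟨δ, hδ1, hδ2⟩ := (((tendsto_order.1 (hc (fun δ => (1 - δ) ^ n * d) (by fun_prop) (by simp))).1 a ha).and hI).exists
    filter_upwards [key δ hδ2.1 hδ2.2] with r hr using hδ1.trans_le hr.1
  · obtain ⟨δ, hδ1, hδ2⟩ := (((tendsto_order.1 (hc (fun δ => (1 + δ) ^ n * d) (by fun_prop) (by simp))).2 a ha).and hI).exists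
    filter_upwards [key δ hδ2.1 hδ2.2] with r hr using hr.2.trans_lt hδ1

/-- Orthonormal frame of the hyperplane orthogonal to `w`. -/
structure Fr (n : ℕ) (w : Eu n) where
  ι : Tn n →ₗᵢ[ℝ] Eu n
  p : Eu n →L[ℝ] Tn n
  p_ι : ∀ y, p (ι y) = y
  ι_p : ∀ x, ι (p x) = x - ⟪x, w⟫ • w
  orth : ∀ y, ⟪ι y, w⟫ = 0

lemma exists_Fr (w : Eu n) (hw : ‖w‖ = 1) : Nonempty (Fr n w) := by
  have hw0 : w ≠ 0 := by rintro rfl; simp at hw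
  have : Fact (Module.finrank ℝ (Eu n) = n + 1) := ⟨by simp⟩
  let b := OrthonormalBasis.fromOrthogonalSpanSingleton (𝕜 := ℝ) n hw0
  let S := (ℝ ∙ w)ᗮ
  refine ⟨⟨S.subtypeₗᵢ.comp b.repr.symm.toLinearIsometry,
    (b.repr.toContinuousLinearEquiv : S →L[ℝ] Tn n).comp S.orthogonalProjectionOnto, ?_, ?_, ?_⟩⟩
  · intro y
    simp [S]
  · intro x
    have : x - ⟪x, w⟫ • w = S.starProjection x := by
      rw [Submodule.starProjection_orthogonal_val, Submodule.starProjection_singleton]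
      simp [hw, real_inner_comm]
    rw [this]
    simp [S]
  · intro y
    have := (b.repr.symm y).2
    rw [Submodule.mem_orthogonal_singleton_iff_inner_left] at this
    exact this

lemma Fr.inner_p {w : Eu n} (F : Fr n w) (x : Eu n) (v : Tn n) : ⟪F.p x, v⟫ = ⟪x, F.ι v⟫ := by
  rw [← F.ι.inner_map_map, F.ι_p, inner_sub_left, inner_smul_left, real_inner_comm _ w, F.orth]
  simp

lemma Fr.exists_B {w : Eu n} (F : Fr n w) (hw : ‖w‖ = 1) (ν : Eu n) (hν : ‖ν‖ = 1) (hc : 0 < ⟪ν, w⟫) :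
    ∃ B : Tn n ≃L[ℝ] Tn n, |LinearMap.det (B : Tn n →ₗ[ℝ] Tn n)| = ⟪ν, w⟫⁻¹ ∧
      ∀ v, ‖F.ι v - (⟪ν, F.ι v⟫ / ⟪ν, w⟫) • w‖ = ‖B v‖ := by
  set c := ⟪ν, w⟫ with hcdef
  have hpp : ⟪F.p ν, F.p ν⟫ = 1 - c ^ 2 := by
    rw [F.inner_p, F.ι_p, inner_sub_right, inner_smul_right, real_inner_self_eq_norm_sq, hν]
    ring
  let f : Module.Dual ℝ (Tn n) := (c * (1 + c))⁻¹ • (innerₛₗ ℝ (F.p ν))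
  have hf : ∀ v, f v = (c * (1 + c))⁻¹ * ⟪ν, F.ι v⟫ := by
    intro v
    simp only [f, LinearMap.smul_apply, innerₛₗ_apply_apply, smul_eq_mul]
    rw [F.inner_p]
  have hdet : LinearMap.det (LinearMap.transvection f (F.p ν)) = c⁻¹ := by
    rw [LinearMap.transvection.det, hf, ← F.inner_p, hpp]
    field_simp
    ring
  have hne : LinearMap.det (LinearMap.transvection f (F.p ν)) ≠ 0 := by
    rw [hdet]; positivity
  refine ⟨(LinearMap.equivOfDetNeZero _ hne).toContinuousLinearEquiv, ?_, ?_⟩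
  · have : ((LinearMap.equivOfDetNeZero _ hne).toContinuousLinearEquiv : Tn n →ₗ[ℝ] Tn n) =
      LinearMap.transvection f (F.p ν) := by ext; rfl
    rw [this, hdet, abs_of_pos (by positivity)]
  · intro v
    have hBv : (LinearMap.equivOfDetNeZero _ hne).toContinuousLinearEquiv v
        = v + f v • F.p ν := by
      rfl
    rw [hBv, ← sq_eq_sq₀ (norm_nonneg _) (norm_nonneg _)]
    rw [norm_sub_sq_real, norm_add_sq_real]
    rw [inner_smul_right, inner_smul_right, norm_smul, norm_smul, F.orth, F.ι.norm_map,
      real_inner_comm (F.p ν) v, F.inner_p, hf, mul_pow, mul_pow, ← real_inner_self_eq_norm_sq (F.p ν), hpp, hw]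
    simp only [Real.norm_eq_abs, sq_abs]
    field_simp
    ring

/-- Graph chart of the hypersurface over the hyperplane orthogonal to `w`. -/
structure GChart (M : Hypersurface n) (w : Eu n) (F : Fr n w) where
  W : Set (Eu n)
  Ω : Set (Tn n)
  g : Tn n → Eu n
  K : NNReal
  hW : IsOpen W
  hΩ : IsOpen Ω
  bdd : Bornology.IsBounded Ω
  lip : LipschitzOnWith K g Ω
  smooth : ∀ y ∈ Ω, ContDiffAt ℝ 1 g y
  p_g : ∀ y ∈ Ω, F.p (g y) = y
  g_mem : ∀ y ∈ Ω, g y ∈ M.carrier ∩ W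
  p_mem : ∀ x ∈ M.carrier ∩ W, F.p x ∈ Ω ∧ g (F.p x) = x
  pos : ∀ x ∈ M.carrier ∩ W, 0 < ⟪M.nu x, w⟫
  deriv : ∀ y ∈ Ω, ∀ v, fderiv ℝ g y v =
    F.ι v - (⟪M.nu (g y), F.ι v⟫ / ⟪M.nu (g y), w⟫) • w

lemma inner_grad (f : Eu n → ℝ) (x v : Eu n) : ⟪gradient f x, v⟫ = fderiv ℝ f x v := by
  simp [gradient]

lemma Fr.p_w {w : Eu n} (F : Fr n w) (hw : ‖w‖ = 1) : F.p w = 0 := by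
  apply F.ι.injective
  rw [F.ι_p, real_inner_self_eq_norm_sq, hw]; simp

lemma exists_chart (M : Hypersurface n) (x₀ : Eu n) (hx₀ : x₀ ∈ M.carrier) (w : Eu n) (hw : ‖w‖ = 1)
    (hpos : 0 < ⟪M.nu x₀, w⟫) : ∃ (F : Fr n w) (C : GChart M w F), x₀ ∈ C.W := by
  obtain ⟨F⟩ := exists_Fr w hw
  obtain ⟨U, hU, hxU, f, hf, hMU, hgrad, hnu⟩ := M.locally_level_set x₀ hx₀
  have hf1 : ContDiff ℝ 1 f := hf.of_le (by exact_mod_cast le_top)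
  have hM : ∀ x ∈ U, (x ∈ M.carrier ↔ f x = 0) := by
    intro x hx
    have := Set.ext_iff.1 hMU x
    simp only [mem_inter_iff, hx, and_true, mem_ofPred_eq, true_and] at this
    exact this
  have hnuw : ∀ x ∈ M.carrier ∩ U, ∀ v, ⟪M.nu x, v⟫ = ‖gradient f x‖⁻¹ * fderiv ℝ f x v := by
    intro x hx v
    rw [hnu x hx, inner_smul_left, inner_grad]; simp
  have hgp : ∀ x ∈ U, 0 < ‖gradient f x‖⁻¹ := fun x hx => inv_pos.2 (norm_pos_iff.2 (hgrad x hx))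
  let Φ : Eu n → Eu n := fun x => F.ι (F.p x) + f x • w
  have hΦ : ContDiff ℝ 1 Φ := by
    have h1 : ContDiff ℝ 1 (fun x => F.ι (F.p x)) :=
      (F.ι.toContinuousLinearMap.comp F.p).contDiff
    exact h1.add (hf1.smul contDiff_const)
  have hΦd : ∀ x, fderiv ℝ f x w ≠ 0 → ∃ e : Eu n ≃L[ℝ] Eu n, HasFDerivAt Φ (e : Eu n →L[ℝ] Eu n) x := by
    intro x hx
    let A : Eu n →L[ℝ] Eu n := F.ι.toContinuousLinearMap.comp F.p + (fderiv ℝ f x).smulRight w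
    have hA : HasFDerivAt Φ A x := by
      have h1 : HasFDerivAt (fun x => F.ι (F.p x)) (F.ι.toContinuousLinearMap.comp F.p) x :=
        (F.ι.toContinuousLinearMap.comp F.p).hasFDerivAt
      exact h1.add (((hf1.differentiable one_ne_zero) x).hasFDerivAt.smul_const w)
    have hinj : Function.Injective (A : Eu n →ₗ[ℝ] Eu n) := by
      rw [← LinearMap.ker_eq_bot, LinearMap.ker_eq_bot']
      intro h hh
      have hh' : F.ι (F.p h) + fderiv ℝ f x h • w = 0 := by simpa [A] using hh
      have h1 : F.p h = 0 := by
        have := congrArg F.p hh'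
        simpa [F.p_ι, F.p_w hw] using this
      have hw0 : w ≠ 0 := by rintro rfl; simp at hw
      have h2 : fderiv ℝ f x h = 0 := by
        simpa [h1, hw0] using hh'
      have h3 : h = ⟪h, w⟫ • w := by
        have := F.ι_p h
        rw [h1, map_zero] at this
        exact (sub_eq_zero.1 this.symm)
      rw [h3, map_smul, smul_eq_mul] at h2
      rcases mul_eq_zero.1 h2 with h4 | h4
      · rw [h3, h4, zero_smul]
      · exact absurd h4 hx
    refine ⟨(LinearEquiv.ofInjectiveEndo (A : Eu n →ₗ[ℝ] Eu n) hinj).toContinuousLinearEquiv, ?_⟩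
    convert hA using 1
    ext; rfl
  let U' : Set (Eu n) := U ∩ {x | 0 < fderiv ℝ f x w}
  have hU' : IsOpen U' := by
    refine hU.inter (isOpen_lt continuous_const ?_)
    exact (hf1.continuous_fderiv one_ne_zero).clm_apply continuous_const
  have hx0U' : x₀ ∈ U' := by
    refine ⟨hxU, ?_⟩
    rw [hnuw x₀ ⟨hx₀, hxU⟩] at hpos
    exact (mul_pos_iff_of_pos_left (hgp x₀ hxU)).1 hpos
  obtain ⟨e0, he0⟩ := hΦd x₀ hx0U'.2.ne'
  let e₁ := (hΦ.contDiffAt (x := x₀)).toOpenPartialHomeomorph Φ he0 one_ne_zero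
  have he1c : (e₁ : Eu n → Eu n) = Φ := rfl
  have he1m : x₀ ∈ e₁.source := ContDiffAt.mem_toOpenPartialHomeomorph_source _ he0 one_ne_zero
  let e := e₁.restrOpen U' hU'
  have hec : ∀ x, e x = Φ x := fun x => rfl
  have hes : ∀ x, x ∈ e.source ↔ x ∈ e₁.source ∧ x ∈ U' := by
    intro x; simp [e]
  have hem : x₀ ∈ e.source := (hes _).2 ⟨he1m, hx0U'⟩
  have hesymm : ∀ z ∈ e.target, ContDiffAt ℝ 1 e.symm z := by
    intro z hz
    have h1 := (hes _).1 (e.map_target hz)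
    obtain ⟨e', he'⟩ := hΦd _ h1.2.2.ne'
    exact e.contDiffAt_symm hz he' hΦ.contDiffAt
  have hpΦ : ∀ x, F.p (Φ x) = F.p x := by
    intro x; simp [Φ, F.p_ι, F.p_w hw]
  have hww : ⟪w, w⟫ = 1 := by rw [real_inner_self_eq_norm_sq, hw]; norm_num
  have hwΦ : ∀ x, ⟪Φ x, w⟫ = f x := by
    intro x
    simp only [Φ]
    rw [inner_add_left, F.orth, inner_smul_left, hww]; simp
  let Ω₀ : Set (Tn n) := F.ι ⁻¹' e.target
  have hΩ₀ : IsOpen Ω₀ := e.open_target.preimage F.ι.continuous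
  let g : Tn n → Eu n := fun y => e.symm (F.ι y)
  have hgs : ∀ y ∈ Ω₀, g y ∈ e.source := fun y hy => e.map_target hy
  have hΦg : ∀ y ∈ Ω₀, Φ (g y) = F.ι y := fun y hy => e.right_inv hy
  have hpg : ∀ y ∈ Ω₀, F.p (g y) = y := by
    intro y hy; rw [← hpΦ, hΦg y hy, F.p_ι]
  have hfg : ∀ y ∈ Ω₀, f (g y) = 0 := by
    intro y hy; rw [← hwΦ, hΦg y hy, F.orth]
  have hgM : ∀ y ∈ Ω₀, g y ∈ M.carrier := by
    intro y hy
    exact (hM _ ((hes _).1 (hgs y hy)).2.1).2 (hfg y hy)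
  have hgsm : ∀ y ∈ Ω₀, ContDiffAt ℝ 1 g y := by
    intro y hy
    exact (hesymm _ hy).comp y F.ι.contDiff.contDiffAt
  have hMΦ : ∀ x ∈ M.carrier ∩ e.source, F.ι (F.p x) = Φ x := by
    intro x hx
    have := (hM x ((hes _).1 hx.2).2.1).1 hx.1
    simp [Φ, this]
  have hMΩ : ∀ x ∈ M.carrier ∩ e.source, F.p x ∈ Ω₀ ∧ g (F.p x) = x := by
    intro x hx
    have h1 := hMΦ x hx
    constructor
    · change F.ι (F.p x) ∈ e.target
      rw [h1]; exact e.map_source hx.2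
    · change e.symm (F.ι (F.p x)) = x
      rw [h1]; exact e.left_inv hx.2
  have hp0 := (hMΩ x₀ ⟨hx₀, hem⟩).1
  obtain ⟨K, s, hs, hK⟩ := ((hgsm _ hp0).hasStrictFDerivAt one_ne_zero).exists_lipschitzOnWith
  obtain ⟨r, hr, hrs⟩ := Metric.mem_nhds_iff.1 (inter_mem hs (hΩ₀.mem_nhds hp0))
  refine ⟨F, ⟨e.source ∩ F.p ⁻¹' Metric.ball (F.p x₀) r, Metric.ball (F.p x₀) r, g, K, ?_, ?_, ?_, ?_, ?_,
    ?_, ?_, ?_, ?_, ?_⟩, ⟨hem, Metric.mem_ball_self hr⟩⟩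
  · exact e.open_source.inter (Metric.isOpen_ball.preimage F.p.continuous)
  · exact Metric.isOpen_ball
  · exact Metric.isBounded_ball
  · exact hK.mono fun y hy => (hrs hy).1
  · exact fun y hy => hgsm y (hrs hy).2
  · exact fun y hy => hpg y (hrs hy).2
  · intro y hy
    have := (hrs hy).2
    refine ⟨hgM y this, hgs y this, ?_⟩
    change F.p (g y) ∈ Metric.ball (F.p x₀) r
    rw [hpg y this]; exact hy
  · intro x hx
    exact ⟨hx.2.2, (hMΩ x ⟨hx.1, hx.2.1⟩).2⟩
  · intro x hx
    have h1 := ((hes _).1 hx.2.1).2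
    rw [hnuw x ⟨hx.1, h1.1⟩]
    exact mul_pos (hgp x h1.1) h1.2
  · intro y hy v
    have hy' := (hrs hy).2
    have hd : HasFDerivAt g (fderiv ℝ g y) y := ((hgsm y hy').differentiableAt one_ne_zero).hasFDerivAt
    have h1 : F.p (fderiv ℝ g y v) = v := by
      have a1 := (F.p.hasFDerivAt).comp y hd
      have a2 : HasFDerivAt (F.p ∘ g) (ContinuousLinearMap.id ℝ (Tn n)) y := by
        refine (hasFDerivAt_id y).congr_of_eventuallyEq ?_
        filter_upwards [hΩ₀.mem_nhds hy'] with z hz using hpg z hz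
      simpa using congrArg (fun L => L v) (a1.unique a2)
    have h2 : fderiv ℝ f (g y) (fderiv ℝ g y v) = 0 := by
      have a1 := ((hf1.differentiable one_ne_zero) (g y)).hasFDerivAt.comp y hd
      have a2 : HasFDerivAt (f ∘ g) (0 : Tn n →L[ℝ] ℝ) y := by
        refine (hasFDerivAt_const (0:ℝ) y).congr_of_eventuallyEq ?_
        filter_upwards [hΩ₀.mem_nhds hy'] with z hz using hfg z hz
      simpa using congrArg (fun L => L v) (a1.unique a2)
    have hU1 := ((hes _).1 (hgs y hy')).2
    have h3 : ⟪M.nu (g y), fderiv ℝ g y v⟫ = 0 := by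
      rw [hnuw _ ⟨hgM y hy', hU1.1⟩, h2, mul_zero]
    have hc : 0 < ⟪M.nu (g y), w⟫ := by
      rw [hnuw _ ⟨hgM y hy', hU1.1⟩]
      exact mul_pos (hgp _ hU1.1) hU1.2
    have h4 := F.ι_p (fderiv ℝ g y v)
    rw [h1] at h4
    have h5 : fderiv ℝ g y v = F.ι v + ⟪fderiv ℝ g y v, w⟫ • w := by rw [h4]; simp
    rw [h5, inner_add_right, inner_smul_right] at h3
    have h6 : ⟪fderiv ℝ g y v, w⟫ = - (⟪M.nu (g y), F.ι v⟫ / ⟪M.nu (g y), w⟫) := by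
      field_simp
      linarith
    rw [h5, h6]
    simp [sub_eq_add_neg]

lemma carrier_meas (M : Hypersurface n) : MeasurableSet M.carrier := by
  have : IsLocallyClosed M.carrier := by
    refine ((isLocallyClosed_tfae M.carrier).out 0 3).2 ?_
    intro x hx
    obtain ⟨U, hU, hxU, f, hf, hMU, -, -⟩ := M.locally_level_set x hx
    refine ⟨U, hxU, hU, ?_⟩
    rintro y ⟨hyU, hy⟩
    have h1 : y ∈ closure (M.carrier ∩ U) := by
      rw [inter_comm]; exact hU.inter_closure ⟨hyU, hy⟩
    have h2 : IsClosed {z | f z = 0} := isClosed_eq hf.continuous continuous_const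
    have h3 : M.carrier ∩ U ⊆ {z | f z = 0} := by
      rw [hMU]; exact fun z hz => hz.2
    have h4 : f y = 0 := closure_minimal h3 h2 h1
    have h5 : y ∈ M.carrier ∩ U := by rw [hMU]; exact ⟨hyU, h4⟩
    exact h5.1
  obtain ⟨A, B, hA, hB, h⟩ := this
  rw [h]; exact hA.measurableSet.inter hB.measurableSet

namespace GChart
variable {M : Hypersurface n} {w : Eu n} {F : Fr n w} (C : GChart M w F)

lemma contOn : ContinuousOn C.g C.Ω := C.lip.continuousOn

lemma measMW : MeasurableSet (M.carrier ∩ C.W) := (carrier_meas M).inter C.hW.measurableSet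

lemma map_apply (A : Set (Tn n)) (hA : MeasurableSet A) :
    (Measure.map F.p (μH[(n : ℝ)].restrict (M.carrier ∩ C.W))) A = μH[(n : ℝ)] (C.g '' (A ∩ C.Ω)) := by
  rw [Measure.map_apply F.p.continuous.measurable hA,
    Measure.restrict_apply (F.p.continuous.measurable hA)]
  congr 1
  ext x
  constructor
  · rintro ⟨h1, h2⟩
    exact ⟨F.p x, ⟨h1, (C.p_mem x h2).1⟩, (C.p_mem x h2).2⟩
  · rintro ⟨y, ⟨h1, h2⟩, rfl⟩
    refine ⟨?_, C.g_mem y h2⟩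
    rw [mem_preimage, C.p_g y h2]; exact h1

lemma image_le (s : Set (Tn n)) (hs : s ⊆ C.Ω) :
    μH[(n : ℝ)] (C.g '' s) ≤ (C.K : ENNReal) ^ (n : ℝ) * μH[(n : ℝ)] s :=
  (C.lip.mono hs).hausdorffMeasure_image_le (by positivity)

lemma image_eq : C.g '' C.Ω = M.carrier ∩ C.W := by
  ext x
  constructor
  · rintro ⟨y, hy, rfl⟩; exact C.g_mem y hy
  · intro hx; exact ⟨F.p x, C.p_mem x hx⟩

lemma finite : μH[(n : ℝ)] (M.carrier ∩ C.W) < ⊤ := by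
  rw [← C.image_eq]
  refine (C.image_le C.Ω subset_rfl).trans_lt (ENNReal.mul_lt_top ?_ ?_)
  · exact ENNReal.rpow_lt_top_of_nonneg (by positivity) ENNReal.coe_ne_top
  · exact C.bdd.measure_lt_top

lemma map_eq (hw : ‖w‖ = 1) : Measure.map F.p (μH[(n : ℝ)].restrict (M.carrier ∩ C.W)) =
    (μH[(n : ℝ)].restrict C.Ω).withDensity
      (fun y => ((Real.toNNReal ⟪M.nu (C.g y), w⟫⁻¹ : NNReal) : ENNReal)) := by
  set μ := Measure.map F.p (μH[(n : ℝ)].restrict (M.carrier ∩ C.W)) with hμ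
  have hfin : IsFiniteMeasure μ := by
    constructor
    rw [C.map_apply _ MeasurableSet.univ, univ_inter, C.image_eq]
    exact C.finite
  have hac : μ ≪ (μH[(n : ℝ)] : Measure (Tn n)) := by
    refine Measure.AbsolutelyContinuous.mk fun s hs h0 => ?_
    rw [C.map_apply s hs]
    refine le_antisymm ((C.image_le _ inter_subset_right).trans ?_) (zero_le)
    rw [measure_mono_null inter_subset_left h0, mul_zero]
  have h1 := Measure.withDensity_rnDeriv_eq μ _ hac
  have h2 : μ.restrict C.Ω = μ := by
    apply Measure.restrict_eq_self_of_ae_mem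
    rw [ae_iff]
    change μ (C.Ωᶜ) = 0
    rw [C.map_apply _ C.hΩ.measurableSet.compl]
    simp
  rw [← h2, ← h1, restrict_withDensity C.hΩ.measurableSet]
  apply withDensity_congr_ae
  rw [EventuallyEq, ae_restrict_iff' C.hΩ.measurableSet]
  filter_upwards [Besicovitch.ae_tendsto_rnDeriv μ μH[(n : ℝ)]] with y hy hyΩ
  have hgM := C.g_mem y hyΩ
  obtain ⟨B, hB1, hB2⟩ := F.exists_B hw (M.nu (C.g y)) (M.unit_nu _ hgM.1) (C.pos _ hgM)
  have h3 := area_ratio C.g F.p (fderiv ℝ C.g y) B y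
    (by filter_upwards [C.hΩ.mem_nhds hyΩ] with z hz using C.p_g z hz)
    ((C.smooth y hyΩ).hasStrictFDerivAt one_ne_zero)
    (fun v => by rw [C.deriv y hyΩ v]; exact hB2 v)
  rw [hB1] at h3
  refine tendsto_nhds_unique hy (h3.congr' ?_)
  obtain ⟨r₀, hr₀, hr₀'⟩ := Metric.nhds_basis_closedBall.mem_iff.1 (C.hΩ.mem_nhds hyΩ)
  filter_upwards [Ioc_mem_nhdsGT hr₀] with r hr
  rw [C.map_apply _ Metric.isClosed_closedBall.measurableSet,
    inter_eq_left.2 ((Metric.closedBall_subset_closedBall hr.2).trans hr₀')]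

lemma integral_eq (hw : ‖w‖ = 1) (G : Eu n → ℝ) (hG : Continuous G) :
    ∫ x in M.carrier ∩ C.W, G x ∂μH[(n : ℝ)] =
      ∫ y in C.Ω, ⟪M.nu (C.g y), w⟫⁻¹ * G (C.g y) ∂μH[(n : ℝ)] := by
  have hGg : AEStronglyMeasurable (fun y => G (C.g y)) (μH[(n : ℝ)].restrict C.Ω) :=
    (hG.comp_continuousOn C.contOn).aestronglyMeasurable C.hΩ.measurableSet
  have hm : AEMeasurable (fun y => Real.toNNReal ⟪M.nu (C.g y), w⟫⁻¹) (μH[(n : ℝ)].restrict C.Ω) := by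
    have h1 : ContinuousOn (fun y => ⟪M.nu (C.g y), w⟫⁻¹) C.Ω := by
      refine ContinuousOn.inv₀ ?_ fun y hy => (C.pos _ (C.g_mem y hy)).ne'
      exact (M.smooth_nu.continuous.comp_continuousOn C.contOn).inner continuousOn_const
    exact (h1.aemeasurable C.hΩ.measurableSet).real_toNNReal
  calc ∫ x in M.carrier ∩ C.W, G x ∂μH[(n : ℝ)]
      = ∫ x in M.carrier ∩ C.W, G (C.g (F.p x)) ∂μH[(n : ℝ)] := by
        refine setIntegral_congr_fun C.measMW fun x hx => ?_
        simp only [(C.p_mem x hx).2]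
    _ = ∫ y, G (C.g y) ∂(Measure.map F.p (μH[(n : ℝ)].restrict (M.carrier ∩ C.W))) := by
        rw [integral_map F.p.continuous.aemeasurable]
        rw [C.map_eq hw]
        exact hGg.mono_ac (withDensity_absolutelyContinuous _ _)
    _ = _ := by
        rw [C.map_eq hw, integral_withDensity_eq_integral_smul₀ hm]
        refine setIntegral_congr_fun C.hΩ.measurableSet fun y hy => ?_
        have := C.pos _ (C.g_mem y hy)
        simp only [NNReal.smul_def, smul_eq_mul]
        rw [Real.coe_toNNReal _ (by positivity)]
end GChart

/-- The tangential (Günter) derivative. -/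
def gunter (M : Hypersurface n) (a b : Eu n) (ψ : Eu n → ℝ) (x : Eu n) : ℝ :=
  ⟪M.nu x, a⟫ * fderiv ℝ ψ x b - ⟪M.nu x, b⟫ * fderiv ℝ ψ x a

lemma gunter_cont (M : Hypersurface n) (a b : Eu n) (ψ : Eu n → ℝ) (hψ : ContDiff ℝ 1 ψ) :
    Continuous (gunter M a b ψ) := by
  have h1 := hψ.continuous_fderiv one_ne_zero
  have h2 := M.smooth_nu.continuous
  unfold gunter
  fun_prop

lemma tang_const (M : Hypersurface n) (x : Eu n) (hx : x ∈ M.carrier) (ψ : Eu n → ℝ)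
    (hψ : ContDiff ℝ 1 ψ) (h : ∀ᶠ y in 𝓝[M.carrier] x, ψ y = ψ x) :
    ∃ l : ℝ, ∀ v, fderiv ℝ ψ x v = l * ⟪M.nu x, v⟫ := by
  obtain ⟨U, hU, hxU, f, hf, hMU, hgrad, hnu⟩ := M.locally_level_set x hx
  have hf1 : ContDiff ℝ 1 f := hf.of_le (by exact_mod_cast le_top)
  have hfx : f x = 0 := by
    have : x ∈ M.carrier ∩ U := ⟨hx, hxU⟩
    rw [hMU] at this; exact this.2
  have hext : IsLocalExtrOn ψ {y | f y = f x} x := by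
    left
    have h1 : 𝓝[{y | f y = f x}] x ≤ 𝓝[M.carrier] x := by
      rw [← nhdsWithin_inter_of_mem' (s := {y | f y = f x}) (t := U)
        (mem_nhdsWithin_of_mem_nhds (hU.mem_nhds hxU))]
      apply nhdsWithin_mono
      rintro y ⟨hy1, hy2⟩
      have : y ∈ M.carrier ∩ U := by
        rw [hMU]; exact ⟨hy2, by rw [← hfx]; exact hy1⟩
      exact this.1
    filter_upwards [h1 h] with y hy
    exact le_of_eq hy.symm
  obtain ⟨a, b, hab, h0⟩ := hext.exists_multipliers_of_hasStrictFDerivAt_1d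
    (hf1.contDiffAt.hasStrictFDerivAt one_ne_zero) (hψ.contDiffAt.hasStrictFDerivAt one_ne_zero)
  have h0' : ∀ v, a * fderiv ℝ f x v + b * fderiv ℝ ψ x v = 0 := fun v => by
    simpa using congrArg (fun L => L v) h0
  have hb : b ≠ 0 := by
    rintro rfl
    have ha : a ≠ 0 := by
      rintro rfl; simp at hab
    apply hgrad x hxU
    have : ⟪gradient f x, gradient f x⟫ = 0 := by
      rw [inner_grad]
      have := h0' (gradient f x)
      simpa [ha] using this
    exact inner_self_eq_zero.1 this
  refine ⟨-(a / b) * ‖gradient f x‖, fun v => ?_⟩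
  rw [hnu x ⟨hx, hxU⟩, inner_smul_left, inner_grad]
  have hg : ‖gradient f x‖ ≠ 0 := norm_ne_zero_iff.2 (hgrad x hxU)
  have := h0' v
  simp only [conj_trivial]
  field_simp
  linarith

lemma gunter_zero (M : Hypersurface n) (x : Eu n) (hx : x ∈ M.carrier) (ψ : Eu n → ℝ)
    (hψ : ContDiff ℝ 1 ψ) (h : ∀ᶠ y in 𝓝[M.carrier] x, ψ y = ψ x) (a b : Eu n) :
    gunter M a b ψ x = 0 := by
  obtain ⟨l, hl⟩ := tang_const M x hx ψ hψ h
  simp only [gunter, hl]; ring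

lemma ev_zero {S K : Set (Eu n)} {ψ : Eu n → ℝ} (hK : IsCompact K)
    (h : ∀ x ∈ S, x ∉ K → ψ x = 0) (x : Eu n) (hx : x ∈ S) (hxK : x ∉ K) :
    ∀ᶠ y in 𝓝[S] x, ψ y = ψ x := by
  rw [h x hx hxK]
  filter_upwards [self_mem_nhdsWithin, mem_nhdsWithin_of_mem_nhds (hK.isClosed.isOpen_compl.mem_nhds hxK)]
    with y hy1 hy2 using h y hy1 hy2

lemma GChart.gunter_int {M : Hypersurface n} {w : Eu n} {F : Fr n w} (C : GChart M w F)
    (hw : ‖w‖ = 1) (ψ : Eu n → ℝ) (hψ : ContDiff ℝ 1 ψ) (K : Set (Eu n)) (hK : IsCompact K)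
    (hKM : K ⊆ M.carrier ∩ C.W) (h0 : ∀ x ∈ M.carrier, x ∉ K → ψ x = 0) (b : Eu n) :
    ∫ x in M.carrier ∩ C.W, gunter M w b ψ x ∂μH[(n : ℝ)] = 0 := by
  have hb : ∀ x, gunter M w b ψ x = gunter M w (F.ι (F.p b)) ψ x := by
    intro x
    simp only [gunter, F.ι_p, map_sub, map_smul, inner_sub_right, inner_smul_right, smul_eq_mul]
    ring
  rw [C.integral_eq hw _ (gunter_cont M w b ψ hψ)]
  set v := F.p b
  let h : Tn n → ℝ := C.Ω.indicator (fun y => ψ (C.g y))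
  let Q : Set (Tn n) := F.p '' K
  have hQ : IsCompact Q := hK.image F.p.continuous
  have hQ0 : ∀ y, y ∉ Q → h y = 0 := by
    intro y hy
    by_cases hyΩ : y ∈ C.Ω
    · simp only [h, indicator_of_mem hyΩ]
      apply h0 _ (C.g_mem y hyΩ).1
      intro hk
      exact hy ⟨_, hk, C.p_g y hyΩ⟩
    · simp [h, hyΩ]
  have hQΩ : Q ⊆ C.Ω := by
    rintro _ ⟨x, hx, rfl⟩
    exact (C.p_mem x (hKM hx)).1
  have heΩ : ∀ y ∈ C.Ω, h =ᶠ[𝓝 y] fun y => ψ (C.g y) := by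
    intro y hy
    filter_upwards [C.hΩ.mem_nhds hy] with z hz
    simp [h, hz]
  have heQ : ∀ y, y ∉ Q → h =ᶠ[𝓝 y] fun _ => 0 := by
    intro y hy
    filter_upwards [hQ.isClosed.isOpen_compl.mem_nhds hy] with z hz using hQ0 z hz
  have hh : ContDiff ℝ 1 h := by
    rw [contDiff_iff_contDiffAt]
    intro y
    by_cases hy : y ∈ Q
    · exact (hψ.contDiffAt.comp y (C.smooth y (hQΩ hy))).congr_of_eventuallyEq (heΩ y (hQΩ hy))
    · exact contDiffAt_const.congr_of_eventuallyEq (heQ y hy)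
  have hcs : HasCompactSupport h := HasCompactSupport.intro hQ hQ0
  have hd : ∀ y ∈ C.Ω, ⟪M.nu (C.g y), w⟫⁻¹ * gunter M w b ψ (C.g y) = fderiv ℝ h y v := by
    intro y hy
    have hc := C.pos _ (C.g_mem y hy)
    rw [(heΩ y hy).fderiv_eq]
    have : fderiv ℝ (fun y => ψ (C.g y)) y = (fderiv ℝ ψ (C.g y)).comp (fderiv ℝ C.g y) :=
      fderiv_comp y (hψ.differentiable one_ne_zero _) ((C.smooth y hy).differentiableAt one_ne_zero)
    rw [this, hb]
    simp only [ContinuousLinearMap.comp_apply, C.deriv y hy, gunter, map_sub, map_smul, smul_eq_mul]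
    field_simp
  rw [setIntegral_congr_fun C.hΩ.measurableSet hd,
    setIntegral_eq_integral_of_forall_compl_eq_zero]
  · have hci : Continuous (fun y => fderiv ℝ h y v) :=
      (hh.continuous_fderiv one_ne_zero).clm_apply continuous_const
    have hcsd : HasCompactSupport (fun y => fderiv ℝ h y v) := hcs.fderiv_apply ℝ v
    have := integral_mul_fderiv_eq_neg_fderiv_mul_of_integrable (μ := (μH[(n : ℝ)] : Measure (Tn n)))
      (f := fun _ => (1:ℝ)) (g := h) (v := v) (by simp)
      (by simpa using hci.integrable_of_hasCompactSupport hcsd)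
      (by simpa using hh.continuous.integrable_of_hasCompactSupport hcs)
      (by intro x _; fun_prop) (by intro x _; exact hh.differentiable one_ne_zero x)
    simpa using this
  · intro y hy
    have : y ∉ Q := fun hq => hy (hQΩ hq)
    rw [(heQ y this).fderiv_eq]; simp

lemma compact_fin (M : Hypersurface n) (K : Set (Eu n)) (hK : IsCompact K) (hKM : K ⊆ M.carrier) :
    μH[(n : ℝ)] K < ⊤ := by
  refine hK.measure_lt_top_of_nhdsWithin fun x hx => ?_
  obtain ⟨F, C, hC⟩ := exists_chart M x (hKM hx) (M.nu x) (M.unit_nu x (hKM hx))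
    (by rw [real_inner_self_eq_norm_sq, M.unit_nu x (hKM hx)]; norm_num)
  refine ⟨M.carrier ∩ C.W, ?_, C.finite⟩
  exact inter_mem (mem_of_superset self_mem_nhdsWithin hKM)
    (mem_nhdsWithin_of_mem_nhds (C.hW.mem_nhds hC))

lemma integ_of_cont (M : Hypersurface n) (K : Set (Eu n)) (hK : IsCompact K) (hKM : K ⊆ M.carrier)
    (G : Eu n → ℝ) (hG : ContinuousOn G K) (h0 : ∀ x ∈ M.carrier, x ∉ K → G x = 0) :
    IntegrableOn G M.carrier μH[(n : ℝ)] := by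
  have h1 : IntegrableOn G K μH[(n : ℝ)] := by
    obtain ⟨c, hc⟩ := hK.exists_bound_of_continuousOn hG
    have : IsFiniteMeasure (μH[(n : ℝ)].restrict K) :=
      ⟨by rw [Measure.restrict_apply_univ]; exact compact_fin M K hK hKM⟩
    exact Integrable.of_bound (hG.aestronglyMeasurable hK.measurableSet) c
      ((ae_restrict_iff' hK.measurableSet).2 (ae_of_all _ hc))
  exact h1.of_forall_sdiff_eq_zero (carrier_meas M) fun x hx => h0 x hx.1 hx.2

lemma gunter_local (M : Hypersurface n) (x₀ : Eu n) (hx₀ : x₀ ∈ M.carrier) (a b : Eu n) :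
    ∃ W : Set (Eu n), IsOpen W ∧ x₀ ∈ W ∧ ∀ (ψ : Eu n → ℝ) (K : Set (Eu n)), ContDiff ℝ 1 ψ →
      IsCompact K → K ⊆ M.carrier ∩ W → (∀ x ∈ M.carrier, x ∉ K → ψ x = 0) →
      ∫ x in M.carrier, gunter M a b ψ x ∂μH[(n : ℝ)] = 0 := by
  have hν := M.unit_nu x₀ hx₀
  set ν := M.nu x₀ with hνdef
  have hνν : ⟪ν, ν⟫ = 1 := by rw [real_inner_self_eq_norm_sq, hν]; norm_num
  set s : ℝ := (1 + ‖a‖)⁻¹ with hs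
  have hs0 : 0 < s := by positivity
  have h1 : 0 < ⟪ν, ν + s • a⟫ := by
    rw [inner_add_right, inner_smul_right, hνν]
    have h2 := neg_le_of_abs_le (abs_real_inner_le_norm ν a)
    rw [hν, one_mul] at h2
    have h3 : s * ‖a‖ < 1 := by
      rw [hs, inv_mul_lt_one₀ (by positivity)]; linarith
    nlinarith
  have hne : ν + s • a ≠ 0 := by
    intro h; rw [h] at h1; simp at h1
  set t : ℝ := ‖ν + s • a‖⁻¹ with ht
  have ht0 : 0 < t := inv_pos.2 (norm_pos_iff.2 hne)
  have hw2 : ‖t • (ν + s • a)‖ = 1 := by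
    rw [norm_smul, Real.norm_eq_abs, abs_of_pos ht0, ht, inv_mul_cancel₀ (norm_ne_zero_iff.2 hne)]
  obtain ⟨F₁, C₁, hC₁⟩ := exists_chart M x₀ hx₀ ν hν (by rw [← hνdef, hνν]; norm_num)
  obtain ⟨F₂, C₂, hC₂⟩ := exists_chart M x₀ hx₀ (t • (ν + s • a)) hw2
    (by rw [← hνdef, inner_smul_right]; positivity)
  refine ⟨C₁.W ∩ C₂.W, C₁.hW.inter C₂.hW, ⟨hC₁, hC₂⟩, ?_⟩
  intro ψ K hψ hK hKM h0
  have hz : ∀ c, ∀ x ∈ M.carrier, x ∉ K → gunter M c b ψ x = 0 := fun c x hx hxK =>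
    gunter_zero M x hx ψ hψ (ev_zero hK h0 x hx hxK) c b
  have hi : ∀ c, IntegrableOn (gunter M c b ψ) M.carrier μH[(n : ℝ)] := fun c =>
    integ_of_cont M K hK (fun x hx => (hKM hx).1) _ (gunter_cont M c b ψ hψ).continuousOn (hz c)
  have hfull : ∀ (c : Eu n) (W : Set (Eu n)), IsOpen W → K ⊆ W →
      ∫ x in M.carrier ∩ W, gunter M c b ψ x ∂μH[(n : ℝ)] =
      ∫ x in M.carrier, gunter M c b ψ x ∂μH[(n : ℝ)] := by
    intro c W hW hKW
    refine (setIntegral_eq_of_subset_of_forall_sdiff_eq_zero (carrier_meas M) inter_subset_left ?_).symm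
    intro x hx
    exact hz c x hx.1 fun hk => hx.2 ⟨hx.1, hKW hk⟩
  have e1 := C₁.gunter_int hν ψ hψ K hK (fun x hx => ⟨(hKM hx).1, (hKM hx).2.1⟩) h0 b
  have e2 := C₂.gunter_int hw2 ψ hψ K hK (fun x hx => ⟨(hKM hx).1, (hKM hx).2.2⟩) h0 b
  rw [hfull _ _ C₁.hW fun x hx => (hKM hx).2.1] at e1
  rw [hfull _ _ C₂.hW fun x hx => (hKM hx).2.2] at e2
  have hlin : ∀ x, gunter M a b ψ x = s⁻¹ * (t⁻¹ * gunter M (t • (ν + s • a)) b ψ x - gunter M ν b ψ x) := by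
    intro x
    simp only [gunter, inner_smul_right, inner_add_right, map_smul, map_add, smul_eq_mul]
    field_simp
    ring
  simp_rw [hlin]
  rw [integral_const_mul, integral_sub ((hi _).const_mul _) (hi _), integral_const_mul, e1, e2]
  simp

lemma gunter_global (M : Hypersurface n) (a b : Eu n) (ψ : Eu n → ℝ) (K : Set (Eu n))
    (hψ : ContDiff ℝ 1 ψ) (hK : IsCompact K) (hKM : K ⊆ M.carrier)
    (h0 : ∀ x ∈ M.carrier, x ∉ K → ψ x = 0) :
    ∫ x in M.carrier, gunter M a b ψ x ∂μH[(n : ℝ)] = 0 := by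
  choose! W hWo hxW hW using fun x (hx : x ∈ M.carrier) => gunter_local M x hx a b
  have hbump : ∀ x ∈ M.carrier, ∃ f : ContDiffBump x, Metric.closedBall x f.rOut ⊆ W x := by
    intro x hx
    obtain ⟨r, hr, hrs⟩ := Metric.nhds_basis_closedBall.mem_iff.1 ((hWo x hx).mem_nhds (hxW x hx))
    exact ⟨⟨r / 2, r, by positivity, by linarith⟩, hrs⟩
  choose! f hf using hbump
  have key : ∀ t : Finset (Eu n), (∀ x ∈ t, x ∈ M.carrier) → ∀ ψ : Eu n → ℝ, ContDiff ℝ 1 ψ →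
      (∀ x ∈ M.carrier, x ∉ K → ψ x = 0) →
      (∀ x ∈ M.carrier, (∀ i ∈ t, x ∉ Metric.ball i (f i).rIn) → ψ x = 0) →
      ∫ x in M.carrier, gunter M a b ψ x ∂μH[(n : ℝ)] = 0 := by
    intro t
    induction t using Finset.induction_on with
    | empty =>
      intro _ ψ hψ _ h
      have : ∀ x ∈ M.carrier, ψ x = 0 := fun x hx => h x hx (by simp)
      rw [setIntegral_congr_fun (g := fun _ => (0:ℝ)) (carrier_meas M)]
      · simp
      intro x hx
      refine gunter_zero M x hx ψ hψ ?_ a b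
      filter_upwards [self_mem_nhdsWithin] with y hy
      rw [this y hy, this x hx]
    | insert i t hit ih =>
      intro ht ψ hψ h1 h2
      have hiM := ht i (Finset.mem_insert_self _ _)
      have hfi : ContDiff ℝ 1 (f i) := (f i).contDiff
      have hA : ContDiff ℝ 1 (fun x => f i x * ψ x) := hfi.mul hψ
      have hB : ContDiff ℝ 1 (fun x => (1 - f i x) * ψ x) := (contDiff_const.sub hfi).mul hψ
      have iA := hW i hiM (fun x => f i x * ψ x) (K ∩ Metric.closedBall i (f i).rOut) hA
        (hK.inter_right Metric.isClosed_closedBall)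
        (fun x hx => ⟨hKM hx.1, hf i hiM hx.2⟩) (by
          intro x hx hxn
          by_cases hxK : x ∈ K
          · have : x ∉ Metric.closedBall i (f i).rOut := fun h => hxn ⟨hxK, h⟩
            rw [Metric.mem_closedBall, not_le] at this
            rw [(f i).zero_of_le_dist this.le, zero_mul]
          · rw [h1 x hx hxK, mul_zero])
      have iB := ih (fun x hx => ht x (Finset.mem_insert_of_mem hx)) (fun x => (1 - f i x) * ψ x) hB
        (fun x hx hxK => by rw [h1 x hx hxK, mul_zero]) (by
          intro x hx hxt
          by_cases hxi : x ∈ Metric.ball i (f i).rIn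
          · rw [(f i).one_of_mem_closedBall (Metric.ball_subset_closedBall hxi)]; simp
          · rw [h2 x hx, mul_zero]
            intro j hj
            rcases Finset.mem_insert.1 hj with rfl | hj
            · exact hxi
            · exact hxt j hj)
      have hi : ∀ χ : Eu n → ℝ, ContDiff ℝ 1 χ → (∀ x ∈ M.carrier, x ∉ K → χ x = 0) →
          IntegrableOn (gunter M a b χ) M.carrier μH[(n : ℝ)] := fun χ hχ hχ0 =>
        integ_of_cont M K hK hKM _ (gunter_cont M a b χ hχ).continuousOn fun x hx hxK =>
          gunter_zero M x hx χ hχ (ev_zero hK hχ0 x hx hxK) a b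
      have hsum : ∀ x, gunter M a b ψ x = gunter M a b (fun x => f i x * ψ x) x
          + gunter M a b (fun x => (1 - f i x) * ψ x) x := by
        intro x
        have hs : ψ = fun x => f i x * ψ x + (1 - f i x) * ψ x := by ext x; ring
        have hd := fderiv_fun_add (hA.differentiable one_ne_zero x) (hB.differentiable one_ne_zero x)
        rw [← hs] at hd
        simp only [gunter, hd, add_apply]
        ring
      simp_rw [hsum]
      rw [integral_add (hi _ hA fun x hx hxK => by rw [h1 x hx hxK, mul_zero])
        (hi _ hB fun x hx hxK => by rw [h1 x hx hxK, mul_zero]), iA, iB, add_zero]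
  obtain ⟨t, ht, hKt⟩ := hK.elim_nhds_subcover (fun x => Metric.ball x (f x).rIn)
    (fun x hx => Metric.ball_mem_nhds x (f x).rIn_pos)
  refine key t (fun x hx => hKM (ht x hx)) ψ hψ h0 fun x hx hxt => ?_
  apply h0 x hx
  intro hxK
  obtain ⟨i, hi, hxi⟩ := mem_iUnion₂.1 (hKt hxK)
  exact hxt i hi hxi

/-- Standard basis vector. -/
def eb (i : Fin (n + 1)) : Eu n := EuclideanSpace.single i 1

lemma inner_eb (x : Eu n) (i : Fin (n + 1)) : ⟪x, eb i⟫ = x i := by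
  simp [eb, EuclideanSpace.inner_single_right]

lemma inner_coords (x y : Eu n) : ⟪x, y⟫ = ∑ i, x i * y i := by
  simp [PiLp.inner_apply, mul_comm]

lemma eb_apply (i j : Fin (n + 1)) : (eb i : Eu n) j = if j = i then 1 else 0 := by
  simp [eb, PiLp.single_apply]

lemma sum_lin (L : Eu n →L[ℝ] ℝ) (u : Eu n) : ∑ i, u i * L (eb i) = L u := by
  have : u = ∑ i, u i • (eb i : Eu n) := by
    ext j
    simp [eb_apply]
  conv_rhs => rw [this]
  simp

lemma nu_coord_smooth (M : Hypersurface n) (j : Fin (n + 1)) : ContDiff ℝ 1 (fun y => M.nu y j) := by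
  have h : ContDiff ℝ 1 M.nu := M.smooth_nu.of_le (by exact_mod_cast le_top)
  exact (contDiff_euclidean.1 h) j

lemma coord_smooth (j : Fin (n + 1)) : ContDiff ℝ 1 (fun y : Eu n => y j) :=
  (contDiff_euclidean.1 contDiff_id) j

lemma coord_deriv (j : Fin (n + 1)) (x v : Eu n) : fderiv ℝ (fun y : Eu n => y j) x v = v j := by
  have : HasFDerivAt (fun y : Eu n => y j) (EuclideanSpace.proj j : Eu n →L[ℝ] ℝ) x :=
    (EuclideanSpace.proj j : Eu n →L[ℝ] ℝ).hasFDerivAt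
  rw [this.fderiv]; rfl

lemma nu_tang (M : Hypersurface n) (x : Eu n) (hx : x ∈ M.carrier) :
    ∃ l : ℝ, ∀ v, ∑ i, M.nu x i * fderiv ℝ (fun y => M.nu y i) x v = l * ⟪M.nu x, v⟫ := by
  have hs : ContDiff ℝ 1 (fun y => ∑ i, M.nu y i * M.nu y i) :=
    ContDiff.sum fun i _ => (nu_coord_smooth M i).mul (nu_coord_smooth M i)
  have h1 : ∀ y ∈ M.carrier, ∑ i, M.nu y i * M.nu y i = 1 := by
    intro y hy
    rw [← inner_coords, real_inner_self_eq_norm_sq, M.unit_nu y hy]; norm_num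
  obtain ⟨l, hl⟩ := tang_const M x hx _ hs (by
    filter_upwards [self_mem_nhdsWithin] with y hy
    rw [h1 y hy, h1 x hx])
  refine ⟨l / 2, fun v => ?_⟩
  have h2 := hl v
  have hd : ∀ i, DifferentiableAt ℝ (fun y => M.nu y i) x := fun i =>
    (nu_coord_smooth M i).differentiable one_ne_zero x
  rw [fderiv_fun_sum fun i _ => (hd i).fun_mul (hd i)] at h2
  simp only [sum_apply, fderiv_fun_mul (hd _) (hd _), add_apply, smul_apply, smul_eq_mul] at h2
  rw [Finset.sum_add_distrib] at h2
  linarith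

lemma meanCurv_eq (M : Hypersurface n) (x : Eu n) :
    meanCurv M x = ∑ i, fderiv ℝ (fun y => M.nu y i) x (eb i)
      - ∑ i, M.nu x i * fderiv ℝ (fun y => M.nu y i) x (M.nu x) := by
  unfold meanCurv tdiv tderiv
  rw [Finset.sum_sub_distrib]
  congr 1
  refine Finset.sum_congr rfl fun i _ => ?_
  congr 1
  rw [← sum_lin]
  exact Finset.sum_congr rfl fun j _ => mul_comm _ _

/-- Integrand of the divergence theorem for the field `h x`. -/
def divI (M : Hypersurface n) (h : Eu n → ℝ) (x : Eu n) : ℝ :=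
  fderiv ℝ h x x - ⟪x, M.nu x⟫ * fderiv ℝ h x (M.nu x) + n * h x - meanCurv M x * ⟪x, M.nu x⟫ * h x

lemma divI_eq (M : Hypersurface n) (h : Eu n → ℝ) (hh : ContDiff ℝ 1 h) (x : Eu n)
    (hx : x ∈ M.carrier) :
    divI M h x = ∑ i, ∑ j, gunter M (eb j) (eb i) (fun y => M.nu y j * (y i * h y)) x := by
  obtain ⟨l, hl⟩ := nu_tang M x hx
  have hνν : ∑ i, M.nu x i * M.nu x i = 1 := by
    rw [← inner_coords, real_inner_self_eq_norm_sq, M.unit_nu x hx]; norm_num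
  have hνν' : ⟪M.nu x, M.nu x⟫ = 1 := by rw [inner_coords, hνν]
  have hdν : ∀ i, DifferentiableAt ℝ (fun y => M.nu y i) x := fun i =>
    (nu_coord_smooth M i).differentiable one_ne_zero x
  have hdx : ∀ i, DifferentiableAt ℝ (fun y : Eu n => y i) x := fun i =>
    (coord_smooth i).differentiable one_ne_zero x
  have hdh : DifferentiableAt ℝ h x := hh.differentiable one_ne_zero x
  have hk : ∀ i j v, fderiv ℝ (fun y => M.nu y j * (y i * h y)) x v =
      fderiv ℝ (fun y => M.nu y j) x v * x i * h x + M.nu x j * v i * h x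
        + M.nu x j * x i * fderiv ℝ h x v := by
    intro i j v
    rw [fderiv_fun_mul (hdν j) ((hdx i).fun_mul hdh)]
    rw [fderiv_fun_mul (hdx i) hdh]
    simp only [add_apply, smul_apply, smul_eq_mul, coord_deriv]
    ring
  set A := fun j => fderiv ℝ (fun y => M.nu y j) x with hA
  set ν := M.nu x with hν
  have hterm : ∀ i j, gunter M (eb j) (eb i) (fun y => M.nu y j * (y i * h y)) x =
      (h x * x i) * (ν j * A j (eb i)) + (h x + x i * fderiv ℝ h x (eb i)) * (ν j * ν j)
      - (ν i * x i * h x) * (A j (eb j)) - (h x * ν i) * (ν j * (eb j : Eu n) i)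
      - (ν i * x i) * (ν j * fderiv ℝ h x (eb j)) := by
    intro i j
    unfold gunter
    rw [hk, hk, inner_eb, inner_eb, eb_apply i i]
    simp only [hA, if_true]
    ring
  have hsj : ∀ i, ∑ j, gunter M (eb j) (eb i) (fun y => M.nu y j * (y i * h y)) x =
      (h x * l) * (x i * ν i) + (h x + x i * fderiv ℝ h x (eb i))
      - (h x * ∑ j, A j (eb j)) * (x i * ν i) - h x * (ν i * ν i)
      - (fderiv ℝ h x ν) * (x i * ν i) := by
    intro i
    simp_rw [hterm]
    rw [Finset.sum_sub_distrib, Finset.sum_sub_distrib, Finset.sum_sub_distrib, Finset.sum_add_distrib,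
      ← Finset.mul_sum, ← Finset.mul_sum, ← Finset.mul_sum, ← Finset.mul_sum, ← Finset.mul_sum]
    rw [hl, hνν, sum_lin, inner_eb]
    have : ∑ j, ν j * (eb j : Eu n) i = ν i := by simp [eb_apply]
    rw [this]
    ring
  simp_rw [hsj]
  rw [Finset.sum_sub_distrib, Finset.sum_sub_distrib, Finset.sum_sub_distrib, Finset.sum_add_distrib,
    ← Finset.mul_sum, ← Finset.mul_sum, ← Finset.mul_sum, ← Finset.mul_sum, Finset.sum_add_distrib,
    sum_lin, hνν, ← inner_coords]
  unfold divI
  rw [meanCurv_eq, hl, hνν']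
  simp only [Finset.sum_const, Finset.card_univ, Fintype.card_fin, nsmul_eq_mul]
  push_cast
  ring

lemma divI_integral (M : Hypersurface n) (h : Eu n → ℝ) (hh : ContDiff ℝ 1 h) (K : Set (Eu n))
    (hK : IsCompact K) (hKM : K ⊆ M.carrier) (h0 : ∀ x ∈ M.carrier, x ∉ K → h x = 0) :
    IntegrableOn (divI M h) M.carrier μH[(n : ℝ)] ∧
    ∫ x in M.carrier, divI M h x ∂μH[(n : ℝ)] = 0 := by
  have hs : ∀ i j, ContDiff ℝ 1 (fun y => M.nu y j * (y i * h y)) := fun i j =>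
    (nu_coord_smooth M j).mul ((coord_smooth i).mul hh)
  have hz : ∀ i j, ∀ x ∈ M.carrier, x ∉ K → M.nu x j * (x i * h x) = 0 := by
    intro i j x hx hxK; rw [h0 x hx hxK]; ring
  have hi : ∀ i j, IntegrableOn (gunter M (eb j) (eb i) (fun y => M.nu y j * (y i * h y)))
      M.carrier μH[(n : ℝ)] := fun i j =>
    integ_of_cont M K hK hKM _ (gunter_cont M _ _ _ (hs i j)).continuousOn fun x hx hxK =>
      gunter_zero M x hx _ (hs i j) (ev_zero hK (hz i j) x hx hxK) _ _
  constructor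
  · refine IntegrableOn.congr_fun (f := fun x => ∑ i, ∑ j, gunter M (eb j) (eb i) (fun y => M.nu y j * (y i * h y)) x)
      ?_ (fun x hx => (divI_eq M h hh x hx).symm) (carrier_meas M)
    exact integrable_finsetSum _ fun i _ => integrable_finsetSum _ fun j _ => hi i j
  · rw [setIntegral_congr_fun (carrier_meas M) (fun x hx => divI_eq M h hh x hx)]
    rw [integral_finsetSum _ fun i _ => integrable_finsetSum _ fun j _ => hi i j]
    refine Finset.sum_eq_zero fun i _ => ?_
    rw [integral_finsetSum _ fun j _ => hi i j]
    exact Finset.sum_eq_zero fun j _ => gunter_global M _ _ _ K (hs i j) hK hKM (hz i j)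

lemma fatou_real {X : Type*} [MeasurableSpace X] {μ : Measure X} {F : ℕ → X → ℝ} {f : X → ℝ} {c : ℝ}
    (h0 : ∀ k x, 0 ≤ F k x) (hF : ∀ k, Measurable (F k)) (hI : ∀ k, Integrable (F k) μ)
    (hc : ∀ k, ∫ x, F k x ∂μ ≤ c)
    (hf : Measurable f) (hf0 : ∀ x, 0 ≤ f x)
    (hl : ∀ᵐ x ∂μ, Tendsto (fun k => F k x) atTop (𝓝 (f x))) :
    Integrable f μ ∧ ∫ x, f x ∂μ ≤ c := by
  have hc0 : 0 ≤ c := (integral_nonneg (h0 0)).trans (hc 0)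
  have h1 : ∫⁻ x, ENNReal.ofReal (f x) ∂μ ≤ ENNReal.ofReal c := by
    calc ∫⁻ x, ENNReal.ofReal (f x) ∂μ
        = ∫⁻ x, liminf (fun k => ENNReal.ofReal (F k x)) atTop ∂μ := by
          apply lintegral_congr_ae
          filter_upwards [hl] with x hx
          exact ((ENNReal.continuous_ofReal.tendsto _).comp hx).liminf_eq.symm
      _ ≤ liminf (fun k => ∫⁻ x, ENNReal.ofReal (F k x) ∂μ) atTop :=
          lintegral_liminf_le fun k => (hF k).ennreal_ofReal
      _ ≤ ENNReal.ofReal c := by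
          refine liminf_le_of_frequently_le' (Frequently.of_forall fun k => ?_)
          rw [← ofReal_integral_eq_lintegral_ofReal (hI k) (ae_of_all _ (h0 k))]
          exact ENNReal.ofReal_le_ofReal (hc k)
  have hi : Integrable f μ := by
    refine ⟨hf.aestronglyMeasurable, ?_⟩
    rw [hasFiniteIntegral_iff_ofReal (ae_of_all _ hf0)]
    exact h1.trans_lt ENNReal.ofReal_lt_top
  refine ⟨hi, ?_⟩
  rw [← ofReal_integral_eq_lintegral_ofReal hi (ae_of_all _ hf0)] at h1
  exact (ENNReal.ofReal_le_ofReal_iff hc0).1 h1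

lemma meanCurv_cont (M : Hypersurface n) : Continuous (meanCurv M) := by
  have : meanCurv M = fun x => ∑ i, fderiv ℝ (fun y => M.nu y i) x (eb i)
      - ∑ i, M.nu x i * fderiv ℝ (fun y => M.nu y i) x (M.nu x) := by
    ext x; exact meanCurv_eq M x
  rw [this]
  have h1 : ∀ i, Continuous (fun x => fderiv ℝ (fun y => M.nu y i) x) := fun i =>
    (nu_coord_smooth M i).continuous_fderiv one_ne_zero
  have h2 : ∀ i, Continuous (fun x => M.nu x i) := fun i => (nu_coord_smooth M i).continuous
  have h3 := M.smooth_nu.continuous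
  refine Continuous.sub ?_ ?_
  · exact continuous_finsetSum _ fun i _ => (h1 i).clm_apply continuous_const
  · exact continuous_finsetSum _ fun i _ => (h2 i).mul ((h1 i).clm_apply h3)

lemma tgrad_cont (M : Hypersurface n) (φ : Eu n → ℝ) (hφ : ContDiff ℝ 1 φ) :
    Continuous (tgrad M.nu φ) := by
  have h1 : Continuous (gradient φ) :=
    (InnerProductSpace.toDual ℝ (Eu n)).symm.continuous.comp (hφ.continuous_fderiv one_ne_zero)
  have h3 := M.smooth_nu.continuous
  unfold tgrad
  fun_prop

lemma tgrad_zero (M : Hypersurface n) (x : Eu n) (hx : x ∈ M.carrier) (φ : Eu n → ℝ)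
    (hφ : ContDiff ℝ 1 φ) (h : ∀ᶠ y in 𝓝[M.carrier] x, φ y = φ x) : tgrad M.nu φ x = 0 := by
  obtain ⟨l, hl⟩ := tang_const M x hx φ hφ h
  have : gradient φ x = l • M.nu x := by
    apply ext_inner_right ℝ
    intro v
    rw [inner_grad, hl, inner_smul_left]; simp
  unfold tgrad
  rw [this, inner_smul_left, real_inner_self_eq_norm_sq, M.unit_nu x hx]
  simp

/-- The regularised weight. -/
def hreg (φ : Eu n → ℝ) (ε : ℝ) (x : Eu n) : ℝ := φ x ^ 2 * (‖x‖ ^ 2 + ε)⁻¹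

lemma hreg_smooth (φ : Eu n → ℝ) (hφ : ContDiff ℝ 1 φ) (ε : ℝ) (hε : 0 < ε) :
    ContDiff ℝ 1 (hreg φ ε) := by
  refine (hφ.pow 2).mul (ContDiff.inv ((contDiff_norm_sq ℝ).add contDiff_const) fun x => ?_)
  positivity

lemma hreg_deriv (φ : Eu n → ℝ) (hφ : ContDiff ℝ 1 φ) (ε : ℝ) (hε : 0 < ε) (x v : Eu n) :
    fderiv ℝ (hreg φ ε) x v = 2 * φ x * fderiv ℝ φ x v / (‖x‖ ^ 2 + ε)
      - φ x ^ 2 * (2 * ⟪x, v⟫) / (‖x‖ ^ 2 + ε) ^ 2 := by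
  have hr : ‖x‖ ^ 2 + ε ≠ 0 := by positivity
  have h1 : HasFDerivAt (fun y : Eu n => ‖y‖ ^ 2 + ε) (2 • (innerSL ℝ x)) x :=
    (hasStrictFDerivAt_norm_sq x).hasFDerivAt.add_const ε
  have h2 := (hasDerivAt_inv hr).comp_hasFDerivAt x h1
  have h3 := (hφ.differentiable one_ne_zero x).hasFDerivAt.pow 2
  have h4 := h3.mul h2
  have h5 : HasFDerivAt (hreg φ ε) _ x := h4
  rw [h5.fderiv]
  simp [Function.comp]
  field_simp
  ring

lemma pointwise (M : Hypersurface n) (φ : Eu n → ℝ) (hφ : ContDiff ℝ 1 φ) (ε : ℝ) (hε : 0 < ε)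
    (x : Eu n) (hx : x ∈ M.carrier) (α : ℝ) (hα0 : 0 < α) (hα : (n : ℝ) = 2 * α + 2) :
    α ^ 2 * (φ x ^ 2 / (‖x‖ ^ 2 + ε)) + (2 * α + α ^ 2) * (φ x ^ 2 * (⟪x, M.nu x⟫ / (‖x‖ ^ 2 + ε)) ^ 2)
    ≤ ‖tgrad M.nu φ x‖ ^ 2 + α * (|meanCurv M x| * |⟪x, M.nu x⟫| * φ x ^ 2 / (‖x‖ ^ 2 + ε))
      + α * divI M (hreg φ ε) x := by
  set s := ⟪x, M.nu x⟫ with hs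
  set r := ‖x‖ ^ 2 + ε with hr
  have hr0 : 0 < r := by positivity
  have hνν : ⟪M.nu x, M.nu x⟫ = 1 := by rw [real_inner_self_eq_norm_sq, M.unit_nu x hx]; norm_num
  set τ := tgrad M.nu φ x with hτ
  have hτν : ⟪τ, M.nu x⟫ = 0 := by
    rw [hτ, tgrad, inner_sub_left, inner_smul_left, hνν]; simp
  set P := ⟪τ, x⟫ with hP
  have hP' : P = fderiv ℝ φ x x - s * fderiv ℝ φ x (M.nu x) := by
    rw [hP, hτ, tgrad, inner_sub_left, inner_smul_left, inner_grad, inner_grad, hs, real_inner_comm (M.nu x) x]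
    simp [mul_comm]
  have hsq : 0 ≤ ‖τ‖ ^ 2 + 2 * α * φ x * P / r + α ^ 2 * φ x ^ 2 * (‖x‖ ^ 2 - s ^ 2) / r ^ 2 := by
    have h1 : ‖x - s • M.nu x‖ ^ 2 = ‖x‖ ^ 2 - s ^ 2 := by
      rw [norm_sub_sq_real, inner_smul_right, norm_smul, M.unit_nu x hx, ← hs, mul_one, Real.norm_eq_abs, sq_abs]
      ring
    have h2 : ⟪τ, x - s • M.nu x⟫ = P := by
      rw [inner_sub_right, inner_smul_right, hτν]; simp [hP]
    have h3 : ‖τ + (α * φ x / r) • (x - s • M.nu x)‖ ^ 2 =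
        ‖τ‖ ^ 2 + 2 * α * φ x * P / r + α ^ 2 * φ x ^ 2 * (‖x‖ ^ 2 - s ^ 2) / r ^ 2 := by
      rw [norm_add_sq_real, inner_smul_right, norm_smul, h2, mul_pow, h1, Real.norm_eq_abs, sq_abs]
      ring
    rw [← h3]; positivity
  have hdiv : divI M (hreg φ ε) x = 2 * φ x * P / r - 2 * φ x ^ 2 * (‖x‖ ^ 2 - s ^ 2) / r ^ 2
      + n * (φ x ^ 2 / r) - meanCurv M x * s * (φ x ^ 2 / r) := by
    unfold divI
    rw [hreg_deriv φ hφ ε hε, hreg_deriv φ hφ ε hε, hP', ← hs, real_inner_self_eq_norm_sq, ← hr]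
    simp only [hreg, ← hr]
    ring
  have hH : meanCurv M x * s * (φ x ^ 2 / r) ≤ |meanCurv M x| * |s| * φ x ^ 2 / r := by
    rw [mul_div_assoc, ← abs_mul]
    exact mul_le_mul_of_nonneg_right (le_abs_self _) (by positivity)
  have hH' := mul_le_mul_of_nonneg_left hH hα0.le
  have hq : (‖x‖ ^ 2 - s ^ 2) / r ^ 2 ≤ 1 / r - (s / r) ^ 2 := by
    have : ‖x‖ ^ 2 = r - ε := by rw [hr]; ring
    rw [this]
    have h1 : 1 / r - (s / r) ^ 2 - (r - ε - s ^ 2) / r ^ 2 = ε / r ^ 2 := by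
      field_simp; ring
    have h2 : 0 ≤ ε / r ^ 2 := by positivity
    linarith
  have hq' := mul_le_mul_of_nonneg_left hq (show 0 ≤ (2 * α + α ^ 2) * φ x ^ 2 by positivity)
  rw [hdiv, hα]
  have e1 : (2 * α + α ^ 2) * φ x ^ 2 * ((‖x‖ ^ 2 - s ^ 2) / r ^ 2) =
    α * (2 * φ x ^ 2 * (‖x‖ ^ 2 - s ^ 2) / r ^ 2) + α ^ 2 * φ x ^ 2 * (‖x‖ ^ 2 - s ^ 2) / r ^ 2 := by ring
  have e2 : (2 * α + α ^ 2) * φ x ^ 2 * (1 / r - (s / r) ^ 2) =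
    (2 * α + α ^ 2) * (φ x ^ 2 / r) - (2 * α + α ^ 2) * (φ x ^ 2 * (s / r) ^ 2) := by ring
  have e3 : 2 * α * φ x * P / r = α * (2 * φ x * P / r) := by ring
  rw [e3] at hsq
  nlinarith [hsq, hq', hH', e1, e2]

lemma carron_aux (M : Hypersurface n) (φ : Eu n → ℝ) (hφ : ContDiff ℝ 1 φ) (K : Set (Eu n))
    (hK : IsCompact K) (hKM : K ⊆ M.carrier) (h0 : ∀ x ∈ M.carrier, x ∉ K → φ x = 0)
    (α : ℝ) (hα0 : 0 < α) (hα : (n : ℝ) = 2 * α + 2) :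
    α ^ 2 * ∫ x, φ x ^ 2 / ‖x‖ ^ 2 ∂surfMeasure M
      + (2 * α + α ^ 2)
          * ∫ x, (⟪x, M.nu x⟫ / ‖x‖) ^ 2 * (φ x ^ 2 / ‖x‖ ^ 2) ∂surfMeasure M
    ≤ ∫ x, ‖tgrad M.nu φ x‖ ^ 2
        + α * (|meanCurv M x| * φ x ^ 2 / ‖x‖) ∂surfMeasure M := by
  set μ := surfMeasure M with hμ
  have hmeas := carrier_meas M
  have hn0 : (0 : ℝ) < n := by linarith
  have cφ := hφ.continuous
  have cH := meanCurv_cont M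
  have cτ := tgrad_cont M φ hφ
  have cν := M.smooth_nu.continuous
  have cs : Continuous (fun x : Eu n => ⟪x, M.nu x⟫) := continuous_id.inner cν
  have aeM : ∀ᵐ x ∂μ, x ∈ M.carrier := ae_restrict_mem hmeas
  have ae0 : ∀ᵐ x ∂μ, x ≠ 0 := by
    have := Measure.nullSingletonClass_hausdorff (Eu n) hn0
    apply ae_restrict_of_ae
    rw [ae_iff]
    simp
  have hsle : ∀ x ∈ M.carrier, |⟪x, M.nu x⟫| ≤ ‖x‖ := fun x hx => by
    have := abs_real_inner_le_norm x (M.nu x)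
    rwa [M.unit_nu x hx, mul_one] at this
  have integ : ∀ G : Eu n → ℝ, Continuous G → (∀ x ∈ M.carrier, x ∉ K → G x = 0) →
      Integrable G μ := fun G hG h => integ_of_cont M K hK hKM G hG.continuousOn h
  have hτ0 : ∀ x ∈ M.carrier, x ∉ K → tgrad M.nu φ x = 0 := fun x hx hxK =>
    tgrad_zero M x hx φ hφ (ev_zero hK h0 x hx hxK)
  have iτ : Integrable (fun x => ‖tgrad M.nu φ x‖ ^ 2) μ :=
    integ _ (cτ.norm.pow 2) fun x hx hxK => by simp [hτ0 x hx hxK]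
  have iH2 : Integrable (fun x => meanCurv M x ^ 2 / 2 * φ x ^ 2) μ :=
    integ _ (by fun_prop) fun x hx hxK => by simp [h0 x hx hxK]
  set e : ℕ → ℝ := fun k => 1 / ((k : ℝ) + 1) with he
  have he0 : ∀ k, 0 < e k := fun k => by positivity
  have het : Tendsto e atTop (𝓝 0) := tendsto_one_div_add_atTop_nhds_zero_nat
  have hrt : ∀ x : Eu n, Tendsto (fun k => ‖x‖ ^ 2 + e k) atTop (𝓝 (‖x‖ ^ 2)) := fun x => by
    simpa using (tendsto_const_nhds (x := ‖x‖ ^ 2)).add het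
  have hr0 : ∀ k (x : Eu n), ‖x‖ ^ 2 + e k ≠ 0 := fun k x => by have := he0 k; positivity
  have hD : ∀ k, Integrable (divI M (hreg φ (e k))) μ ∧ ∫ x, divI M (hreg φ (e k)) x ∂μ = 0 :=
    fun k => divI_integral M _ (hreg_smooth φ hφ _ (he0 k)) K hK hKM fun x hx hxK => by
      simp [hreg, h0 x hx hxK]
  have hadd : ∀ (G : Eu n → ℝ) k, Integrable G μ →
      ∫ x, G x ∂μ = ∫ x, G x + α * divI M (hreg φ (e k)) x ∂μ := fun G k hG => by
    rw [integral_add hG ((hD k).1.const_mul _), integral_const_mul, (hD k).2]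
    simp
  have c1 : ∀ k, Continuous (fun x => φ x ^ 2 / (‖x‖ ^ 2 + e k)) := fun k =>
    (cφ.pow 2).div (by fun_prop) (hr0 k)
  have i1 : ∀ k, Integrable (fun x => φ x ^ 2 / (‖x‖ ^ 2 + e k)) μ := fun k =>
    integ _ (c1 k) fun x hx hxK => by simp [h0 x hx hxK]
  have c2 : ∀ k, Continuous (fun x => φ x ^ 2 * (⟪x, M.nu x⟫ / (‖x‖ ^ 2 + e k)) ^ 2) := fun k =>
    (cφ.pow 2).mul ((cs.div (by fun_prop) (hr0 k)).pow 2)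
  have i2 : ∀ k, Integrable (fun x => φ x ^ 2 * (⟪x, M.nu x⟫ / (‖x‖ ^ 2 + e k)) ^ 2) μ := fun k =>
    integ _ (c2 k) fun x hx hxK => by simp [h0 x hx hxK]
  -- Step A
  have hA : Integrable (fun x => α ^ 2 / 2 * (φ x ^ 2 / ‖x‖ ^ 2)) μ := by
    refine (fatou_real (F := fun k x => α ^ 2 / 2 * (φ x ^ 2 / (‖x‖ ^ 2 + e k)))
      (c := ∫ x, ‖tgrad M.nu φ x‖ ^ 2 + meanCurv M x ^ 2 / 2 * φ x ^ 2 ∂μ) ?_ ?_ ?_ ?_ ?_ ?_ ?_).1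
    · intro k x; have := he0 k; positivity
    · intro k; exact ((c1 k).const_mul _).measurable
    · intro k; exact (i1 k).const_mul _
    · intro k
      have : ∫ x, ‖tgrad M.nu φ x‖ ^ 2 + meanCurv M x ^ 2 / 2 * φ x ^ 2 ∂μ =
          ∫ x, (‖tgrad M.nu φ x‖ ^ 2 + meanCurv M x ^ 2 / 2 * φ x ^ 2)
            + α * divI M (hreg φ (e k)) x ∂μ := by
        exact hadd _ k (iτ.add iH2)
      rw [this]
      refine integral_mono_ae ((i1 k).const_mul _) ((iτ.add iH2).add ((hD k).1.const_mul _)) ?_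
      filter_upwards [aeM] with x hx
      have hp := pointwise M φ hφ (e k) (he0 k) x hx α hα0 hα
      have hs := hsle x hx
      have hek := he0 k
      have hr : 0 < ‖x‖ ^ 2 + e k := by positivity
      set r := ‖x‖ ^ 2 + e k
      set t := |⟪x, M.nu x⟫|
      set H := meanCurv M x
      have ht0 : 0 ≤ t := abs_nonneg _
      have ht : t ^ 2 ≤ r := by
        have : t ^ 2 ≤ ‖x‖ ^ 2 := by gcongr
        simp only [r]; linarith
      have h1 : 0 ≤ (α * (t / r) - |H|) ^ 2 := sq_nonneg _
      have h2 : (t / r) ^ 2 ≤ 1 / r := by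
        rw [div_pow, div_le_div_iff₀ (by positivity) hr]; nlinarith
      have h3 : α * (|H| * (t / r)) ≤ α ^ 2 / 2 * (1 / r) + H ^ 2 / 2 := by
        have := mul_le_mul_of_nonneg_left h2 (sq_nonneg α)
        nlinarith [sq_abs H]
      have h4 := mul_le_mul_of_nonneg_right h3 (sq_nonneg (φ x))
      have h5 : 0 ≤ (2 * α + α ^ 2) * (φ x ^ 2 * (⟪x, M.nu x⟫ / r) ^ 2) := by positivity
      have h6 : α * (|H| * (t / r)) * φ x ^ 2 = α * (|H| * t * φ x ^ 2 / r) := by ring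
      have h7 : (α ^ 2 / 2 * (1 / r) + H ^ 2 / 2) * φ x ^ 2 =
        α ^ 2 / 2 * (φ x ^ 2 / r) + H ^ 2 / 2 * φ x ^ 2 := by ring
      rw [h6, h7] at h4
      show α ^ 2 / 2 * (φ x ^ 2 / r) ≤ ‖tgrad M.nu φ x‖ ^ 2 + H ^ 2 / 2 * φ x ^ 2 + α * divI M (hreg φ (e k)) x
      linarith
    · have := cφ.measurable; fun_prop
    · intro x; positivity
    · filter_upwards [ae0] with x hx
      exact (tendsto_const_nhds.div (hrt x) (by positivity)).const_mul _
  have hA1 : Integrable (fun x => φ x ^ 2 / ‖x‖ ^ 2) μ := by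
    have := hA.const_mul (α ^ 2 / 2)⁻¹
    refine this.congr (ae_of_all _ fun x => ?_)
    field_simp
  have mφ := cφ.measurable
  have mH := cH.measurable
  have ms := cs.measurable
  have iH : Integrable (fun x => |meanCurv M x| * φ x ^ 2 / ‖x‖) μ := by
    refine (iH2.add hA1).mono' ?_ (ae_of_all _ fun x => ?_)
    · have : Measurable (fun x => |meanCurv M x|) := cH.abs.measurable
      have : Measurable (fun x => |meanCurv M x| * φ x ^ 2 / ‖x‖) := by fun_prop
      exact this.aestronglyMeasurable
    · rw [Real.norm_of_nonneg (by positivity)]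
      show |meanCurv M x| * φ x ^ 2 / ‖x‖ ≤ meanCurv M x ^ 2 / 2 * φ x ^ 2 + φ x ^ 2 / ‖x‖ ^ 2
      have h1 : |meanCurv M x| * φ x ^ 2 / ‖x‖ = |meanCurv M x| * (‖x‖⁻¹) * φ x ^ 2 := by ring
      have h2 : meanCurv M x ^ 2 / 2 * φ x ^ 2 + φ x ^ 2 / ‖x‖ ^ 2 =
        (meanCurv M x ^ 2 / 2 + (‖x‖⁻¹) ^ 2) * φ x ^ 2 := by rw [inv_pow]; ring
      rw [h1, h2]
      refine mul_le_mul_of_nonneg_right ?_ (sq_nonneg _)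
      nlinarith [sq_nonneg (|meanCurv M x| - ‖x‖⁻¹), sq_abs (meanCurv M x), sq_nonneg (‖x‖⁻¹)]
  -- Step B
  have hB := fatou_real (μ := μ) (F := fun k x => α ^ 2 * (φ x ^ 2 / (‖x‖ ^ 2 + e k))
        + (2 * α + α ^ 2) * (φ x ^ 2 * (⟪x, M.nu x⟫ / (‖x‖ ^ 2 + e k)) ^ 2))
      (f := fun x => α ^ 2 * (φ x ^ 2 / ‖x‖ ^ 2)
        + (2 * α + α ^ 2) * ((⟪x, M.nu x⟫ / ‖x‖) ^ 2 * (φ x ^ 2 / ‖x‖ ^ 2)))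
      (c := ∫ x, ‖tgrad M.nu φ x‖ ^ 2 + α * (|meanCurv M x| * φ x ^ 2 / ‖x‖) ∂μ)
      (fun k x => by have := he0 k; positivity)
      (fun k => (((c1 k).const_mul _).add ((c2 k).const_mul _)).measurable)
      (fun k => ((i1 k).const_mul _).add ((i2 k).const_mul _)) ?_ (by fun_prop)
      (fun x => by positivity) ?_
  · have i3 : Integrable (fun x => (⟪x, M.nu x⟫ / ‖x‖) ^ 2 * (φ x ^ 2 / ‖x‖ ^ 2)) μ := by
      refine hA1.mono' (by
        have : Measurable (fun x : Eu n => (⟪x, M.nu x⟫ / ‖x‖) ^ 2 * (φ x ^ 2 / ‖x‖ ^ 2)) := by fun_prop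
        exact this.aestronglyMeasurable) ?_
      filter_upwards [aeM] with x hx
      rw [Real.norm_of_nonneg (by positivity)]
      refine mul_le_of_le_one_left (by positivity) ?_
      rw [← sq_abs, abs_div, abs_norm]
      exact pow_le_one₀ (by positivity) (div_le_one_of_le₀ (hsle x hx) (norm_nonneg _))
    have := hB.2
    rwa [integral_add (hA1.const_mul _) (i3.const_mul _), integral_const_mul, integral_const_mul] at this
  · intro k
    have : ∫ x, ‖tgrad M.nu φ x‖ ^ 2 + α * (|meanCurv M x| * φ x ^ 2 / ‖x‖) ∂μ =
          ∫ x, (‖tgrad M.nu φ x‖ ^ 2 + α * (|meanCurv M x| * φ x ^ 2 / ‖x‖))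
            + α * divI M (hreg φ (e k)) x ∂μ := by
      exact hadd _ k (iτ.add (iH.const_mul α))
    rw [this]
    refine integral_mono_ae (((i1 k).const_mul _).add ((i2 k).const_mul _))
      ((iτ.add (iH.const_mul α)).add ((hD k).1.const_mul _)) ?_
    filter_upwards [aeM] with x hx
    refine (pointwise M φ hφ (e k) (he0 k) x hx α hα0 hα).trans ?_
    have hs := hsle x hx
    have hek := he0 k
    show _ ≤ ‖tgrad M.nu φ x‖ ^ 2 + α * (|meanCurv M x| * φ x ^ 2 / ‖x‖) + α * divI M (hreg φ (e k)) x
    gcongr ‖tgrad M.nu φ x‖ ^ 2 + α * ?_ + α * divI M (hreg φ (e k)) x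
    have h1 : |⟪x, M.nu x⟫| / (‖x‖ ^ 2 + e k) ≤ ‖x‖⁻¹ := by
      rcases eq_or_ne x 0 with rfl | hx0
      · simp
      · have : 0 < ‖x‖ := norm_pos_iff.2 hx0
        rw [div_le_iff₀ (by positivity)]
        have h2 : ‖x‖⁻¹ * (‖x‖ ^ 2 + e k) = ‖x‖ + ‖x‖⁻¹ * e k := by field_simp
        rw [h2]
        have : 0 ≤ ‖x‖⁻¹ * e k := by positivity
        linarith
    have h2 := mul_le_mul_of_nonneg_left h1 (show 0 ≤ |meanCurv M x| * φ x ^ 2 by positivity)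
    calc _ = |meanCurv M x| * φ x ^ 2 * (|⟪x, M.nu x⟫| / (‖x‖ ^ 2 + e k)) := by ring
      _ ≤ _ := h2
      _ = _ := by ring
  · filter_upwards [ae0] with x hx
    have hx2 : ‖x‖ ^ 2 ≠ 0 := by positivity
    have t1 : Tendsto (fun k => φ x ^ 2 / (‖x‖ ^ 2 + e k)) atTop (𝓝 (φ x ^ 2 / ‖x‖ ^ 2)) :=
      tendsto_const_nhds.div (hrt x) hx2
    have t2 : Tendsto (fun k => ⟪x, M.nu x⟫ / (‖x‖ ^ 2 + e k)) atTop (𝓝 (⟪x, M.nu x⟫ / ‖x‖ ^ 2)) :=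
      tendsto_const_nhds.div (hrt x) hx2
    have t3 := (t1.const_mul (α ^ 2)).add (((t2.pow 2).const_mul (φ x ^ 2)).const_mul (2 * α + α ^ 2))
    have e4 : (⟪x, M.nu x⟫ / ‖x‖) ^ 2 * (φ x ^ 2 / ‖x‖ ^ 2) = φ x ^ 2 * (⟪x, M.nu x⟫ / ‖x‖ ^ 2) ^ 2 := by
      field_simp
    rw [e4]
    exact t3

end Helpers

/-- Improved Carron-type Hardy inequality on hypersurfaces of `ℝ^{n+1}`, `n ≥ 3`. -/
theorem carron_improved (M : Hypersurface n) (hn : 3 ≤ n) (φ : Eu n → ℝ)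
    (hφ : C1cOn M.carrier φ) :
    ((n : ℝ) - 2) ^ 2 / 4 * ∫ x, φ x ^ 2 / ‖x‖ ^ 2 ∂surfMeasure M
      + ((n : ℝ) ^ 2 - 4) / 4
          * ∫ x, (⟪x, M.nu x⟫ / ‖x‖) ^ 2 * (φ x ^ 2 / ‖x‖ ^ 2) ∂surfMeasure M
    ≤ ∫ x, ‖tgrad M.nu φ x‖ ^ 2
        + ((n : ℝ) - 2) / 2 * (|meanCurv M x| * φ x ^ 2 / ‖x‖) ∂surfMeasure M := by

  obtain ⟨h1, K, hK, hKM, h0⟩ := hφ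
  have hn' : (3 : ℝ) ≤ n := by exact_mod_cast hn
  have h := carron_aux M φ h1 K hK hKM h0 (((n : ℝ) - 2) / 2) (by linarith) (by ring)
  have e1 : (((n : ℝ) - 2) / 2) ^ 2 = ((n : ℝ) - 2) ^ 2 / 4 := by ring
  have e2 : 2 * (((n : ℝ) - 2) / 2) + (((n : ℝ) - 2) / 2) ^ 2 = ((n : ℝ) ^ 2 - 4) / 4 := by ring
  rw [e2, e1] at h
  exact h
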